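/- arXiv:1904.12405 — 2 statements merged into one kernel-verified Lean document; each statement's English description precedes it below -/
import Mathlib

section
/- There exist a positive integer n and an alternating P-bilinear map Ψ₁,₂ : F₁ × F₁ → F₂ which is 2ⁿ-compatible; that is, Ψ₁,₂(x,x) = 0 for all x ∈ F₁, d₂(Ψ₁,₂(x₁,y₁)) = 2ⁿ·(d₁(x₁)·y₁ − d₁(y₁)·x₁) for all x₁, y₁ ∈ F₁, and ψ̄₄(Ψ₁,₂(x₁, d₂x₂), x₂) = 2ⁿ·d₁(x₁)·ψ₄(x₂) for all x₁ ∈ F₁, x₂ ∈ F₂. -/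
open QuadraticMap LinearMap Submodule Function

section Lifting

variable {R : Type*} [CommRing R]
  {A B C D : Type*} [AddCommGroup A] [Module R A] [AddCommGroup B] [Module R B]
  [AddCommGroup C] [Module R C] [AddCommGroup D] [Module R D]

/-- A linear map out of a projective module lifts along any linear map whose range contains
its values. -/
theorem LinearMap.exists_lift_of_mem_range [Module.Projective R A] (d : B →ₗ[R] C)
    (f : A →ₗ[R] C) (hf : ∀ a, f a ∈ range d) : ∃ g : A →ₗ[R] B, ∀ a, d (g a) = f a := by
  obtain ⟨g, hg⟩ := Module.projective_lifting_property d.rangeRestrict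
    (f.codRestrict (range d) hf) d.surjective_rangeRestrict
  exact ⟨g, fun a ↦ congrArg Subtype.val (LinearMap.congr_fun hg a)⟩

/-- A bilinear map out of projective modules lifts along any linear map whose range contains
its values. -/
theorem LinearMap.exists_lift₂_of_mem_range [Module.Projective R A] [Module.Projective R B]
    (d : D →ₗ[R] C) (f : A →ₗ[R] B →ₗ[R] C) (hf : ∀ a b, f a b ∈ range d) :
    ∃ g : A →ₗ[R] B →ₗ[R] D, ∀ a b, d (g a b) = f a b := by
  obtain ⟨g, hg⟩ := exists_lift_of_mem_range d (TensorProduct.lift f) fun t ↦ by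
    induction t with
    | zero => simp
    | tmul a b => simpa using hf a b
    | add x y hx hy => simpa using add_mem hx hy
  exact ⟨TensorProduct.curry g, fun a b ↦ by simp [hg]⟩

/-- An alternating map out of a free module lifts along any linear map whose range contains
its values. -/
theorem AlternatingMap.exists_lift_of_mem_range [Module.Free R A] {n : ℕ} (d : B →ₗ[R] C)
    (f : A [⋀^Fin n]→ₗ[R] C) (hf : ∀ v, f v ∈ range d) :
    ∃ g : A [⋀^Fin n]→ₗ[R] B, ∀ v, d (g v) = f v := by
  obtain ⟨g, hg⟩ := LinearMap.exists_lift_of_mem_range d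
    (exteriorPower.alternatingMapLinearEquiv f) fun t ↦ by
      have ht : t ∈ span R (Set.range (exteriorPower.ιMulti R n (M := A))) := by
        rw [exteriorPower.ιMulti_span]; trivial
      induction ht using span_induction with
      | mem x hx =>
        obtain ⟨v, rfl⟩ := hx
        simpa using hf v
      | zero => simp
      | add x y _ _ hx hy => simpa using add_mem hx hy
      | smul r x _ hx => simpa using smul_mem _ r hx
  exact ⟨g.compAlternatingMap (exteriorPower.ιMulti R n), fun v ↦ by simp [hg]⟩

/-- A trilinear map vanishing when its first two, or its last two, arguments agree, viewed as an
alternating map. -/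
def AlternatingMap.ofTrilinear (f : A →ₗ[R] A →ₗ[R] A →ₗ[R] B)
    (h₁ : ∀ x z, f x x z = 0) (h₂ : ∀ x y, f x y y = 0) : A [⋀^Fin 3]→ₗ[R] B where
  toFun v := f (v 0) (v 1) (v 2)
  map_update_add' := by
    intro hdec v i x y
    obtain rfl := Subsingleton.elim hdec (instDecidableEqFin 3)
    fin_cases i <;> simp [Function.update]
  map_update_smul' := by
    intro hdec v i c x
    obtain rfl := Subsingleton.elim hdec (instDecidableEqFin 3)
    fin_cases i <;> simp [Function.update]
  map_eq_zero_of_eq' v i j hv hij := by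
    have h₃ (x y : A) : f x y x = 0 := by
      have h := h₁ (x + y) x
      simpa only [map_add, LinearMap.add_apply, h₁, h₂, zero_add, add_zero] using h
    fin_cases i <;> fin_cases j <;> simp_all

/-- An alternating map in three variables, viewed as a trilinear map. -/
def AlternatingMap.toTrilinear (f : A [⋀^Fin 3]→ₗ[R] B) : A →ₗ[R] A →ₗ[R] A →ₗ[R] B :=
  have e₀ (a x y z : A) : update ![a, y, z] 0 x = ![x, y, z] := by
    ext i; fin_cases i <;> rfl
  have e₁ (a x y z : A) : update ![x, a, z] 1 y = ![x, y, z] := by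
    ext i; fin_cases i <;> rfl
  have e₂ (a x y z : A) : update ![x, y, a] 2 z = ![x, y, z] := by
    ext i; fin_cases i <;> rfl
  LinearMap.mk₂ R
    (fun x y ↦
      { toFun := fun z ↦ f ![x, y, z]
        map_add' := fun z z' ↦ by simpa only [e₂] using f.map_update_add ![x, y, 0] 2 z z'
        map_smul' := fun c z ↦ by
          simpa only [e₂, RingHom.id_apply] using f.map_update_smul ![x, y, 0] 2 c z })
    (fun x x' y ↦ LinearMap.ext fun z ↦ by
      change f _ = f _ + f _
      simpa only [e₀] using f.map_update_add ![0, y, z] 0 x x')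
    (fun c x y ↦ LinearMap.ext fun z ↦ by
      change f _ = c • f _
      simpa only [e₀] using f.map_update_smul ![0, y, z] 0 c x)
    (fun x y y' ↦ LinearMap.ext fun z ↦ by
      change f _ = f _ + f _
      simpa only [e₁] using f.map_update_add ![x, 0, z] 1 y y')
    (fun c x y ↦ LinearMap.ext fun z ↦ by
      change f _ = c • f _
      simpa only [e₁] using f.map_update_smul ![x, 0, z] 1 c y)

@[simp]
theorem AlternatingMap.toTrilinear_apply (f : A [⋀^Fin 3]→ₗ[R] B) (x y z : A) :
    f.toTrilinear x y z = f ![x, y, z] := rfl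

/-- If every linear map `B → D` vanishing on `e` factors through `d`, then so does every family
of such maps depending linearly on a parameter in a projective module. -/
theorem LinearMap.exists_factor_family {E M : Type*} [AddCommGroup E] [Module R E]
    [AddCommGroup M] [Module R M] [Module.Projective R M] (e : A →ₗ[R] B) (d : B →ₗ[R] C)
    (h : ∀ f : B →ₗ[R] E, (∀ a, f (e a) = 0) → ∃ g : C →ₗ[R] E, ∀ b, g (d b) = f b)
    (f : M →ₗ[R] B →ₗ[R] E) (hf : ∀ m a, f m (e a) = 0) :
    ∃ g : M →ₗ[R] C →ₗ[R] E, ∀ m b, g m (d b) = f m b := by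
  obtain ⟨g, hg⟩ := exists_lift_of_mem_range (lcomp R E d) f fun m ↦ by
    obtain ⟨g, hg⟩ := h (f m) (hf m)
    exact ⟨g, LinearMap.ext hg⟩
  exact ⟨g, fun m b ↦ LinearMap.congr_fun (hg m) b⟩

end Lifting

section SelfDual

variable {P : Type*} [CommRing P]
  {F1 F2 F3 F4 : Type*}
  [AddCommGroup F1] [Module P F1] [AddCommGroup F2] [Module P F2]
  [AddCommGroup F3] [Module P F3] [AddCommGroup F4] [Module P F4]

/-- In a self-dual resolution of length four, a symmetric bilinear form on `F2` which kills the
image of `d3` comes from a bilinear form on `F1`. -/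
theorem exists_bilin_comp_of_symm_of_vanish
    [Module.Free P F1] [Module.Free P F2] [Module.Free P F3]
    {d1 : F1 →ₗ[P] P} {d2 : F2 →ₗ[P] F1} {d3 : F3 →ₗ[P] F2} {d4 : F4 →ₗ[P] F3}
    (hd21 : ∀ x, d1 (d2 x) = 0) (hd43 : ∀ x, d3 (d4 x) = 0)
    (hA : ∀ f : F2 →ₗ[P] F4, (∀ a, f (d3 a) = 0) → ∃ g : F1 →ₗ[P] F4, ∀ b, g (d2 b) = f b)
    (hB : ∀ f : F1 →ₗ[P] F4, (∀ a, f (d2 a) = 0) → ∃ v : F4, ∀ b, d1 b • v = f b)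
    (hC : ∀ f : F3 →ₗ[P] F4, (∀ a, f (d4 a) = 0) → ∃ g : F2 →ₗ[P] F4, ∀ b, g (d3 b) = f b)
    (hD : ∀ v : F4, (∀ u, d1 u • v = 0) → v = 0)
    (ε : F2 →ₗ[P] F2 →ₗ[P] F4) (hsymm : ∀ x y, ε x y = ε y x) (hε : ∀ x w, ε x (d3 w) = 0) :
    ∃ K : F1 →ₗ[P] F1 →ₗ[P] F4, ∀ x y, K (d2 x) (d2 y) = ε x y := by
  obtain ⟨g, hg⟩ := exists_factor_family d3 d2 hA ε hε
  obtain ⟨μ, hμ⟩ := exists_lift_of_mem_range (smulRightₗ (R := P) (M := F4) d1) (g ∘ₗ d3)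
    fun w ↦ by
      obtain ⟨v, hv⟩ := hB (g (d3 w)) fun a ↦ by rw [hg, hsymm, hε]
      exact ⟨v, LinearMap.ext hv⟩
  have hμ' (w : F3) (u : F1) : d1 u • μ w = g (d3 w) u := LinearMap.congr_fun (hμ w) u
  obtain ⟨ν, hν⟩ := hC μ fun v ↦ hD _ fun u ↦ by rw [hμ', hd43, map_zero, LinearMap.zero_apply]
  obtain ⟨K, hK⟩ := exists_factor_family d3 d2 hA (g - (smulRightₗ (R := P) d1) ∘ₗ ν).flip
    fun u w ↦ by simp [hν, hμ']
  exact ⟨K.flip, fun x y ↦ by simp [hK, hg, hd21]⟩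

/-- Up to powers of two, a self-dual resolution of length four carries products
`F1 × F1 → F2` and `F1 × F2 → F3` satisfying the Leibniz rule together with the given products
`F1 × F3 → F4` and `F2 × F2 → F4`. -/
theorem exists_products_of_self_dual
    [Module.Free P F1] [Module.Free P F2] [Module.Free P F3]
    {d1 : F1 →ₗ[P] P} {d2 : F2 →ₗ[P] F1} {d3 : F3 →ₗ[P] F2} {d4 : F4 →ₗ[P] F3}
    (hd21 : ∀ x, d1 (d2 x) = 0) (hd32 : ∀ x, d2 (d3 x) = 0) (hd43 : ∀ x, d3 (d4 x) = 0)
    (hinj4 : Function.Injective d4)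
    (hex3 : range d4 = ker d3) (hex2 : range d3 = ker d2) (hex1 : range d2 = ker d1)
    (hA : ∀ f : F2 →ₗ[P] F4, (∀ a, f (d3 a) = 0) → ∃ g : F1 →ₗ[P] F4, ∀ b, g (d2 b) = f b)
    (hB : ∀ f : F1 →ₗ[P] F4, (∀ a, f (d2 a) = 0) → ∃ v : F4, ∀ b, d1 b • v = f b)
    (hC : ∀ f : F3 →ₗ[P] F4, (∀ a, f (d4 a) = 0) → ∃ g : F2 →ₗ[P] F4, ∀ b, g (d3 b) = f b)
    (hD : ∀ v : F4, (∀ u, d1 u • v = 0) → v = 0)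
    (ψ : F1 →ₗ[P] F3 →ₗ[P] F4) (β : F2 →ₗ[P] F2 →ₗ[P] F4)
    (hsymm : ∀ x y, β x y = β y x)
    (hψ : ∀ x v, ψ x (d4 v) = d1 x • v) (hβ : ∀ x w, β x (d3 w) = -ψ (d2 x) w) :
    ∃ (q₁ : F1 →ₗ[P] F1 →ₗ[P] F2) (q₂ : F1 →ₗ[P] F2 →ₗ[P] F3),
      (∀ x, q₁ x x = 0) ∧
      (∀ x y, d2 (q₁ x y) = (4 : P) • (d1 x • y - d1 y • x)) ∧
      (∀ x z, d3 (q₂ x z) = (4 : P) • d1 x • z - q₁ x (d2 z)) ∧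
      (∀ x w, q₂ x (d3 w) = (4 : P) • (d1 x • w - d4 (ψ x w))) ∧
      (∀ z, q₂ (d2 z) z = (2 : P) • d4 (β z z)) := by
  obtain ⟨p, hp⟩ := exists_lift₂_of_mem_range d2
    (LinearMap.mk₂ P (fun x y ↦ d1 x • y - d1 y • x)
      (fun _ _ _ ↦ by simp only [map_add]; module)
      (fun _ _ _ ↦ by simp only [map_smul, smul_eq_mul]; module)
      (fun _ _ _ ↦ by simp only [map_add]; module)
      (fun _ _ _ ↦ by simp only [map_smul, smul_eq_mul]; module))
    fun x y ↦ by rw [hex1]; simp [mul_comm]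
  simp only [mk₂_apply] at hp
  obtain ⟨p₁, hp₁⟩ : ∃ p₁ : F1 →ₗ[P] F1 →ₗ[P] F2, ∀ x y, p₁ x y = p x y - p y x :=
    ⟨p - p.flip, fun _ _ ↦ rfl⟩
  have hdp₁ (x y : F1) : d2 (p₁ x y) = (2 : P) • (d1 x • y - d1 y • x) := by
    rw [hp₁, map_sub, hp, hp]; module
  obtain ⟨p₂, hp₂⟩ := exists_lift₂_of_mem_range d3
    ((2 : P) • lsmul P F2 ∘ₗ d1 - p₁.compl₂ d2) fun x z ↦ by
      rw [hex2, LinearMap.mem_ker]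
      simp only [LinearMap.sub_apply, LinearMap.smul_apply, LinearMap.comp_apply, compl₂_apply,
        map_sub, map_smul, hdp₁, hd21, lsmul_apply]
      module
  replace hp₂ (x : F1) (z : F2) : d3 (p₂ x z) = (2 : P) • d1 x • z - p₁ x (d2 z) := by
    simp [hp₂]
  obtain ⟨s, hs⟩ := exists_lift₂_of_mem_range d4
    ((2 : P) • lsmul P F3 ∘ₗ d1 - p₂.compl₂ d3) fun x w ↦ by
      rw [hex3, LinearMap.mem_ker]
      simp [hp₂, hd32]
  replace hs (x : F1) (w : F3) : d4 (s x w) = (2 : P) • d1 x • w - p₂ x (d3 w) := by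
    simp [hs]
  obtain ⟨h, hh⟩ := exists_factor_family d4 d3 hC (s - (2 : P) • ψ) fun x v ↦ hinj4 (by
    simp [hs, hψ, hd43])
  obtain ⟨r, hr⟩ : ∃ r : F1 →ₗ[P] F2 →ₗ[P] F3, ∀ x z, r x z = p₂ x z + d4 (h x z) :=
    ⟨p₂ + h.compr₂ d4, fun _ _ ↦ rfl⟩
  have hdr (x : F1) (z : F2) : d3 (r x z) = (2 : P) • d1 x • z - p₁ x (d2 z) := by
    rw [hr, map_add, hd43, hp₂, add_zero]
  have hrd (x : F1) (w : F3) : r x (d3 w) = (2 : P) • (d1 x • w - d4 (ψ x w)) := by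
    rw [hr, hh]
    simp only [LinearMap.sub_apply, LinearMap.smul_apply, map_sub, map_smul, hs]
    module
  obtain ⟨c, hc⟩ := exists_lift₂_of_mem_range d4 (r ∘ₗ d2 + (r ∘ₗ d2).flip) fun x y ↦ by
    rw [hex3, LinearMap.mem_ker]
    simp only [LinearMap.add_apply, LinearMap.comp_apply, flip_apply, map_add, hdr, hd21, hp₁]
    module
  replace hc (x y : F2) : d4 (c x y) = r (d2 x) y + r (d2 y) x := by simp [hc]
  obtain ⟨K, hK⟩ := exists_bilin_comp_of_symm_of_vanish hd21 hd43 hA hB hC hD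
    (c - (2 : P) • β) (fun x y ↦ hinj4 (by simp [hc, hsymm x y, add_comm]))
    (fun x w ↦ hinj4 (by simp [hc, hrd, hβ, hd21, hd32]))
  refine ⟨(2 : P) • p₁, (2 : P) • r - (K.compl₂ d2).compr₂ d4, fun x ↦ by simp [hp₁],
    fun x y ↦ ?_, fun x z ↦ ?_, fun x w ↦ ?_, fun z ↦ ?_⟩
  · simp only [LinearMap.smul_apply, map_smul, hdp₁]
    module
  · simp only [LinearMap.smul_apply, LinearMap.sub_apply, map_sub, map_smul, compr₂_apply, hd43,
      hdr]
    module
  · simp only [LinearMap.smul_apply, LinearMap.sub_apply, compr₂_apply, compl₂_apply, hd32,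
      map_zero, hrd]
    module
  · simp only [LinearMap.smul_apply, LinearMap.sub_apply, compr₂_apply, compl₂_apply, hK, map_sub,
      map_smul, hc]
    module

/-- The associator of products as in `exists_products_of_self_dual` is represented, through a
perfect pairing `F1 × F3 → F4`, by an alternating map `F1 × F1 → F3`. -/
theorem exists_alternating_associator [Module.Free P F1]
    {d1 : F1 →ₗ[P] P} {d2 : F2 →ₗ[P] F1} {d3 : F3 →ₗ[P] F2} {d4 : F4 →ₗ[P] F3}
    (hinj4 : Function.Injective d4) (hex3 : range d4 = ker d3)
    (ψ : F1 →ₗ[P] F3 →ₗ[P] F4) (hψ : Function.Bijective ψ.flip)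
    (q₁ : F1 →ₗ[P] F1 →ₗ[P] F2) (q₂ : F1 →ₗ[P] F2 →ₗ[P] F3) (r : P)
    (halt : ∀ x, q₁ x x = 0)
    (hq₁ : ∀ x y, d2 (q₁ x y) = r • (d1 x • y - d1 y • x))
    (hq₂ : ∀ x z, d3 (q₂ x z) = r • d1 x • z - q₁ x (d2 z)) :
    ∃ θ : F1 →ₗ[P] F1 →ₗ[P] F3, (∀ x, θ x x = 0) ∧
      ∀ x u, d4 (ψ u (θ x u)) = q₂ u (q₁ x u) := by
  have hanti (x y : F1) : q₁ y x = -q₁ x y := by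
    have h := halt (x + y)
    simp only [map_add, LinearMap.add_apply, halt, zero_add, add_zero] at h
    exact eq_neg_of_add_eq_zero_left h
  obtain ⟨a, ha⟩ : ∃ a : F1 →ₗ[P] F1 →ₗ[P] F1 →ₗ[P] F3, ∀ x y z, a x y z = q₂ y (q₁ x z) :=
    ⟨((llcomp P F1 F2 F3).flip ∘ₗ q₁).compl₂ q₂, fun _ _ _ ↦ rfl⟩
  have hda (x y z : F1) : d3 (a x y z) =
      r • (d1 y • q₁ x z - d1 x • q₁ y z + d1 z • q₁ y x) := by
    rw [ha, hq₂, hq₁]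
    simp only [map_smul, map_sub]
    module
  obtain ⟨φ, hφ⟩ := AlternatingMap.exists_lift_of_mem_range d3
    (AlternatingMap.ofTrilinear (a.compr₂ (d3.compRight P))
      (fun x z ↦ by simp [hda, halt])
      (fun x y ↦ by simp [hda, halt, hanti x y]))
    fun v ↦ ⟨a (v 0) (v 1) (v 2), rfl⟩
  replace hφ (x y z : F1) : d3 (φ ![x, y, z]) = d3 (a x y z) := hφ ![x, y, z]
  obtain ⟨t, ht⟩ : ∃ t : F1 →ₗ[P] F1 →ₗ[P] F1 →ₗ[P] F3,
      ∀ x z y, t x z y = a x y z - φ ![x, y, z] :=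
    ⟨lflip.toLinearMap ∘ₗ (a - φ.toTrilinear), fun _ _ _ ↦ rfl⟩
  obtain ⟨θ, hθ⟩ := exists_lift₂_of_mem_range (ψ.flip.compr₂ d4) t fun x z ↦ by
    obtain ⟨l, hl⟩ := exists_lift_of_mem_range d4 (t x z) fun y ↦ by
      rw [hex3, LinearMap.mem_ker, ht, map_sub, hφ, sub_self]
    obtain ⟨w, rfl⟩ := hψ.2 l
    exact ⟨w, LinearMap.ext hl⟩
  replace hθ (x z y : F1) : d4 (ψ y (θ x z)) = a x y z - φ ![x, y, z] := by
    rw [← ht, ← hθ]; rfl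
  refine ⟨θ, fun x ↦ hψ.1 (LinearMap.ext fun y ↦ hinj4 ?_), fun x u ↦ ?_⟩
  · rw [flip_apply, hθ, ha, halt, φ.map_eq_zero_of_eq ![x, y, x] (i := 0) (j := 2) rfl (by decide)]
    simp
  · rw [hθ, ha, φ.map_eq_zero_of_eq ![x, u, u] (i := 1) (j := 2) rfl (by decide), sub_zero]

end SelfDual

theorem stmt_5
    (P : Type*) [CommRing P] [IsNoetherianRing P]
    (F1 F2 F3 F4 : Type*)
    [AddCommGroup F1] [Module P F1] [Module.Free P F1] [Module.Finite P F1]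
    [AddCommGroup F2] [Module P F2] [Module.Free P F2] [Module.Finite P F2]
    [AddCommGroup F3] [Module P F3] [Module.Free P F3] [Module.Finite P F3]
    [AddCommGroup F4] [Module P F4] [Module.Free P F4] [Module.Finite P F4]
    (d1 : F1 →ₗ[P] P) (d2 : F2 →ₗ[P] F1) (d3 : F3 →ₗ[P] F2) (d4 : F4 →ₗ[P] F3)
    (hd21 : ∀ x2, d1 (d2 x2) = 0) (hd32 : ∀ x3, d2 (d3 x3) = 0)
    (hd43 : ∀ x4, d3 (d4 x4) = 0)
    (hinj4 : Function.Injective d4)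
    (hex3 : LinearMap.range d4 = LinearMap.ker d3)
    (hex2 : LinearMap.range d3 = LinearMap.ker d2)
    (hex1 : LinearMap.range d2 = LinearMap.ker d1)
    (hrank : Nonempty (F4 ≃ₗ[P] P))
    (ψ3 : F1 →ₗ[P] F3 →ₗ[P] F4) (ψ4 : QuadraticMap P F2 F4)
    (hA2 : ∀ x1 x4, ψ3 x1 (d4 x4) = d1 x1 • x4)
    (hA3 : ∀ x2 x3, polar ψ4 x2 (d3 x3) = - ψ3 (d2 x2) x3)
    (hiso1 : Function.Bijective ψ3)
    (hiso2 : Function.Bijective (polarBilin ψ4))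
    (hiso3 : Function.Bijective ψ3.flip)
    (hreg : ∃ x1, d1 x1 ∈ nonZeroDivisors P)
    : ∃ n : ℕ, 0 < n ∧ ∃ Ψ12 : F1 →ₗ[P] F1 →ₗ[P] F2,
      (∀ x1, Ψ12 x1 x1 = 0) ∧
      (∀ x1 y1, d2 (Ψ12 x1 y1) = (2 ^ n : ℤ) • (d1 x1 • y1 - d1 y1 • x1)) ∧
      (∀ x1 x2, polar ψ4 (Ψ12 x1 (d2 x2)) x2 = (2 ^ n : ℤ) • (d1 x1 • ψ4 x2)) := by
  set β := polarBilin ψ4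
  have hβ (x z : F2) : polar ψ4 x z = β x z := rfl
  simp only [hβ] at hA3 ⊢
  have hsymm (x y : F2) : β x y = β y x := polar_comm _ _ _
  have hself (x : F2) : β x x = (2 : P) • ψ4 x := by
    rw [ofNat_smul_eq_nsmul]; exact polar_self ψ4 x
  have hD (v : F4) (h : ∀ u, d1 u • v = 0) : v = 0 := by
    refine hinj4 (hiso3.1 (LinearMap.ext fun u ↦ ?_))
    simp [hA2, h]
  have hA (f : F2 →ₗ[P] F4) (hf : ∀ a, f (d3 a) = 0) :
      ∃ g : F1 →ₗ[P] F4, ∀ b, g (d2 b) = f b := by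
    obtain ⟨w, rfl⟩ := hiso2.2 f
    have hw : d2 w = 0 := hiso1.1 (LinearMap.ext fun x ↦ by
      simpa [hA3] using hf x)
    obtain ⟨x, rfl⟩ : w ∈ range d3 := hex2 ▸ hw
    exact ⟨-ψ3.flip x, fun b ↦ by rw [hsymm, hA3]; rfl⟩
  have hB (f : F1 →ₗ[P] F4) (hf : ∀ a, f (d2 a) = 0) : ∃ v : F4, ∀ b, d1 b • v = f b := by
    obtain ⟨w, rfl⟩ := hiso3.2 f
    have hw : d3 w = 0 := hiso2.1 (LinearMap.ext fun x ↦ by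
      rw [hsymm, hA3, ← flip_apply, hf]; simp)
    obtain ⟨v, rfl⟩ : w ∈ range d4 := hex3 ▸ hw
    exact ⟨v, fun b ↦ (hA2 b v).symm⟩
  have hC (f : F3 →ₗ[P] F4) (hf : ∀ a, f (d4 a) = 0) :
      ∃ g : F2 →ₗ[P] F4, ∀ b, g (d3 b) = f b := by
    obtain ⟨z, rfl⟩ := hiso1.2 f
    obtain ⟨e⟩ := hrank
    have hz : d1 z = 0 := by
      simpa [hA2] using congrArg e (hf (e.symm 1))
    obtain ⟨m, rfl⟩ : z ∈ range d2 := hex1 ▸ hz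
    exact ⟨-β m, fun b ↦ by simp [hA3]⟩
  obtain ⟨q₁, q₂, halt, hdq₁, hdq₂, hq₂d, hq₂⟩ := exists_products_of_self_dual hd21 hd32 hd43
    hinj4 hex3 hex2 hex1 hA hB hC hD ψ3 β hsymm hA2 hA3
  obtain ⟨θ, hθ₀, hθ⟩ := exists_alternating_associator hinj4 hex3 ψ3 hiso3 q₁ q₂ 4
    halt hdq₁ hdq₂
  refine ⟨4, by norm_num, (4 : P) • q₁ + θ.compr₂ d3, fun x ↦ by simp [halt, hθ₀],
    fun x y ↦ ?_, fun x z ↦ hinj4 ?_⟩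
  · simp only [LinearMap.add_apply, LinearMap.smul_apply, compr₂_apply, map_add, map_smul, hdq₁,
      hd32]
    module
  · have hq₁ : q₁ x (d2 z) = (4 : P) • d1 x • z - d3 (q₂ x z) := by rw [hdq₂]; abel
    have h₁ := hq₂d (d2 z) (q₂ x z)
    rw [hdq₂, map_sub, map_smul, map_smul, hq₂, hself, hd21] at h₁
    have h₂ := hθ x (d2 z)
    rw [hsymm]
    simp only [LinearMap.add_apply, LinearMap.smul_apply, compr₂_apply, map_add, map_smul,
      map_sub, map_neg, map_zsmul, hA3, hq₁, hself]
    simp only [map_smul] at h₁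
    linear_combination (norm := module) h₁ - h₂
end

section
/- There exists an alternating P-bilinear map γ : F₁ × F₁ → F₃ (γ(x,x) = 0) such that ψ₃(d₂x₂, γ(x₁, x₁′)) + ψ̄₄(x₂, α(x₁, x₁′)) = 0 for all x₁, x₁′ ∈ F₁ and x₂ ∈ F₂. -/
open QuadraticMap LinearMap Submodule Function

/-- An alternating bilinear map on a free module lifts, as an alternating map, along any linear map
whose range contains its values. -/
theorem exists_alternating_lift {R M N Q : Type*} [CommRing R]
    [AddCommGroup M] [Module R M] [Module.Free R M]
    [AddCommGroup N] [Module R N] [AddCommGroup Q] [Module R Q]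
    (f : N →ₗ[R] Q) (α : M →ₗ[R] M →ₗ[R] Q) (hα : ∀ x, α x x = 0)
    (hf : ∀ x y, α x y ∈ LinearMap.range f) :
    ∃ γ : M →ₗ[R] M →ₗ[R] N, (∀ x, γ x x = 0) ∧ ∀ x y, f (γ x y) = α x y := by
  classical
  let b := Module.Free.chooseBasis R M
  let _ : LinearOrder (Module.Free.ChooseBasisIndex R M) := linearOrderOfSTO WellOrderingRel
  choose g hg using fun x y => LinearMap.mem_range.1 (hf x y)
  let t : M →ₗ[R] M →ₗ[R] N :=
    b.constr R fun i => b.constr R fun j => if i < j then g (b i) (b j) else 0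
  have ht : ∀ i j, t (b i) (b j) = if i < j then g (b i) (b j) else 0 := fun i j => by
    simp [t, Module.Basis.constr_basis]
  have hlift : (t - t.flip).compr₂ f = α := by
    refine LinearMap.ext_basis b b fun i j => ?_
    simp only [LinearMap.compr₂_apply, LinearMap.sub_apply, LinearMap.flip_apply, map_sub, ht]
    rcases lt_trichotomy i j with h | rfl | h
    · simp [h, h.not_gt, hg]
    · simp [hα]
    · simpa [h, h.not_gt, hg] using LinearMap.IsAlt.neg (B := α) hα (b j) (b i)
  exact ⟨t - t.flip, fun x => by simp, fun x y => LinearMap.congr_fun₂ hlift x y⟩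

theorem stmt_9
    (P : Type*) [CommRing P] [IsNoetherianRing P]
    (F1 F2 F3 F4 : Type*)
    [AddCommGroup F1] [Module P F1] [Module.Free P F1] [Module.Finite P F1]
    [AddCommGroup F2] [Module P F2] [Module.Free P F2] [Module.Finite P F2]
    [AddCommGroup F3] [Module P F3] [Module.Free P F3] [Module.Finite P F3]
    [AddCommGroup F4] [Module P F4] [Module.Free P F4] [Module.Finite P F4]
    (d1 : F1 →ₗ[P] P) (d2 : F2 →ₗ[P] F1) (d3 : F3 →ₗ[P] F2) (d4 : F4 →ₗ[P] F3)
    (hd21 : ∀ x2, d1 (d2 x2) = 0) (hd32 : ∀ x3, d2 (d3 x3) = 0)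
    (hd43 : ∀ x4, d3 (d4 x4) = 0)
    (hinj4 : Function.Injective d4)
    (hex3 : LinearMap.range d4 = LinearMap.ker d3)
    (hex2 : LinearMap.range d3 = LinearMap.ker d2)
    (hex1 : LinearMap.range d2 = LinearMap.ker d1)
    (hrank : Nonempty (F4 ≃ₗ[P] P))
    (φ0 : P ≃ₗ[P] (F4 →ₗ[P] F4)) (φ1 : F1 ≃ₗ[P] (F3 →ₗ[P] F4))
    (φ2 : F2 ≃ₗ[P] (F2 →ₗ[P] F4)) (φ3 : F3 ≃ₗ[P] (F1 →ₗ[P] F4))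
    (φ4 : F4 ≃ₗ[P] (P →ₗ[P] F4))
    (hφ1 : ∀ x1 y4, φ0 (d1 x1) y4 = φ1 x1 (d4 y4))
    (hφ2 : ∀ x2 y3, φ1 (d2 x2) y3 = φ2 x2 (d3 y3))
    (hφ3 : ∀ x3 y2, φ2 (d3 x3) y2 = φ3 x3 (d2 y2))
    (hφ4 : ∀ x4 y1, φ3 (d4 x4) y1 = φ4 x4 (d1 y1))
    (ψ1d : F1 →ₗ[P] F1 →ₗ[P] F2) (hψ1alt : ∀ x1, ψ1d x1 x1 = 0)
    (ψ2d : F1 →ₗ[P] F2 →ₗ[P] F3)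
    (ψ3 : F1 →ₗ[P] F3 →ₗ[P] F4)
    (ψ4 : QuadraticMap P F2 F4)
    (hA2 : ∀ x1 x4, ψ3 x1 (d4 x4) = d1 x1 • x4)
    (hA3 : ∀ x2 x3, polar ψ4 x2 (d3 x3) = - ψ3 (d2 x2) x3)
    (hnewb : ∀ x1 y1, d2 (ψ1d x1 y1) = d1 x1 • y1 - d1 y1 • x1)
    (hbb : ∀ x1 x2, d3 (ψ2d x1 x2) = d1 x1 • x2 - ψ1d x1 (d2 x2))
    (hcc : ∀ x1 x3, d4 (ψ3 x1 x3) = d1 x1 • x3 - ψ2d x1 (d3 x3))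
    (hdd : ∀ x2, d4 (ψ4 x2) = ψ2d (d2 x2) x2)
    (hiso1 : Function.Bijective ψ3)
    (hiso2 : Function.Bijective (polarBilin ψ4))
    (hiso3 : Function.Bijective ψ3.flip)
    (α : F1 →ₗ[P] F1 →ₗ[P] F2) (hαalt : ∀ x1, α x1 x1 = 0)
    (hα : ∀ x1 x1' x2, polar ψ4 x2 (α x1 x1') =
      (2 : ℤ) • polar ψ4 (ψ1d x1 x1') x2 + ψ3 x1' (ψ2d x1 x2) - ψ3 x1 (ψ2d x1' x2))
    : ∃ γ : F1 →ₗ[P] F1 →ₗ[P] F3,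
      (∀ x1, γ x1 x1 = 0) ∧
      (∀ x1 x1' x2, ψ3 (d2 x2) (γ x1 x1') + polar ψ4 x2 (α x1 x1') = 0) := by
  have hψ2 : ∀ x1 x3, ψ2d x1 (d3 x3) = d1 x1 • x3 - d4 (ψ3 x1 x3) := fun x1 x3 => by
    rw [hcc, sub_sub_cancel]
  have hker : ∀ x y, d2 (α x y) = 0 := fun x y => by
    refine hiso1.injective (LinearMap.ext fun x3 => ?_)
    have h := hA3 (α x y) x3
    rw [polar_comm, hα, hA3, hnewb, hψ2, hψ2] at h
    simp only [map_sub, map_smul, LinearMap.sub_apply, LinearMap.smul_apply, hA2] at h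
    rw [map_zero, LinearMap.zero_apply, ← neg_eq_zero, ← h]
    module
  obtain ⟨γ, hγ, hlift⟩ := exists_alternating_lift d3 α hαalt fun x y => hex2 ▸ hker x y
  refine ⟨γ, hγ, fun x y x2 => ?_⟩
  rw [← hlift, hA3, add_neg_cancel]
end
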